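/- Let a⁺ < a⁻ be real numbers. There exists ε > 0, depending only on n, a⁺, a⁻ and on the ellipticity function λ(·) of (H1) and the bound function L(·) of the rescaled condition, with the following property: if u is a Lipschitz solution of the thin obstacle problem in B₁ with F, F₀ satisfying (H0), (H1) and (F, F₀) being ε-rescaled, and u(x) ≤ w(x_{n+1}) + ε for all x ∈ B₁, where w(t) = a⁺ t for t ≥ 0 and w(t) = a⁻ t for t ≤ 0, then B'_{1/2} ⊂ Λ(u), i.e., u vanishes on B'_{1/2}. -/

import Mathlib

open MeasureTheory Metric Filter
open scoped InnerProductSpace NNReal ENNReal Topology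

noncomputable section

/-- Euclidean space `ℝ^{n+1}`. -/
abbrev Eucl (n : ℕ) : Type := EuclideanSpace ℝ (Fin (n + 1))

namespace TOP

variable {n : ℕ}

/-- The `(n+1)`-st standard basis vector `e_{n+1}`. -/
def eLast (n : ℕ) : Eucl n := EuclideanSpace.single (Fin.last n) 1

/-- Open upper half ball `B_r⁺(x₀)`. -/
def hBall (x₀ : Eucl n) (r : ℝ) : Set (Eucl n) :=
  Metric.ball x₀ r ∩ {x : Eucl n | 0 < x (Fin.last n)}

/-- Open lower half ball `B_r⁻(x₀)`. -/
def hBallNeg (x₀ : Eucl n) (r : ℝ) : Set (Eucl n) :=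
  Metric.ball x₀ r ∩ {x : Eucl n | x (Fin.last n) < 0}

/-- Thin ball `B_r'(x₀)`. -/
def tBall (x₀ : Eucl n) (r : ℝ) : Set (Eucl n) :=
  Metric.ball x₀ r ∩ {x : Eucl n | x (Fin.last n) = 0}

/-- (H0): `F` and `F₀` are of class `C¹` on `B₁ × ℝ × ℝ^{n+1}`. -/
def H0 (F : Eucl n → ℝ → Eucl n → Eucl n) (F₀ : Eucl n → ℝ → Eucl n → ℝ) : Prop :=
  ContDiffOn ℝ 1 (fun q : Eucl n × ℝ × Eucl n => F q.1 q.2.1 q.2.2)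
      (Metric.ball (0 : Eucl n) 1 ×ˢ (Set.univ : Set ℝ) ×ˢ (Set.univ : Set (Eucl n))) ∧
    ContDiffOn ℝ 1 (fun q : Eucl n × ℝ × Eucl n => F₀ q.1 q.2.1 q.2.2)
      (Metric.ball (0 : Eucl n) 1 ×ˢ (Set.univ : Set ℝ) ×ˢ (Set.univ : Set (Eucl n)))

/-- (H1): uniform ellipticity of `D_pF` on compact subsets. -/
def H1 (F : Eucl n → ℝ → Eucl n → Eucl n) : Prop :=
  ∀ M : ℝ, 0 < M → ∃ lam : ℝ, 0 < lam ∧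
    ∀ x ∈ Metric.ball (0 : Eucl n) 1, ∀ z : ℝ, |z| ≤ M → ∀ p : Eucl n, ‖p‖ ≤ M →
      ∀ ξ : Eucl n, lam * ‖ξ‖ ^ 2 ≤ ⟪fderiv ℝ (F x z) p ξ, ξ⟫_ℝ

/-- (H1) with a prescribed ellipticity function `lam : M ↦ λ(M)`. -/
def H1With (lam : ℝ → ℝ) (F : Eucl n → ℝ → Eucl n → Eucl n) : Prop :=
  ∀ M : ℝ, 0 < M → 0 < lam M ∧
    ∀ x ∈ Metric.ball (0 : Eucl n) 1, ∀ z : ℝ, |z| ≤ M → ∀ p : Eucl n, ‖p‖ ≤ M →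
      ∀ ξ : Eucl n, lam M * ‖ξ‖ ^ 2 ≤ ⟪fderiv ℝ (F x z) p ξ, ξ⟫_ℝ

/-- `div_x F (x, z, p) = ∑ᵢ ∂_{xᵢ} Fᵢ (x, z, p)`. -/
def divx (F : Eucl n → ℝ → Eucl n → Eucl n) (x : Eucl n) (z : ℝ) (p : Eucl n) : ℝ :=
  ∑ i : Fin (n + 1), fderiv ℝ (fun y : Eucl n => F y z p i) x (EuclideanSpace.single i 1)

/-- `(F, F₀)` is `t`-rescaled with bound function `L : M ↦ L(M)`. -/
def Rescaled (t : ℝ) (L : ℝ → ℝ) (F : Eucl n → ℝ → Eucl n → Eucl n)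
    (F₀ : Eucl n → ℝ → Eucl n → ℝ) : Prop :=
  ∀ M : ℝ, 0 < M → ∀ x ∈ Metric.ball (0 : Eucl n) 1, ∀ z : ℝ, |z| ≤ M →
    ∀ p : Eucl n, ‖p‖ ≤ M →
      |(- divx F x z p - ⟪deriv (fun s : ℝ => F x s p) z, p⟫_ℝ + F₀ x z p)| ≤ t * L M ∧
        ‖fderiv ℝ (F x z) p‖ ≤ L M

/-- The operator `H_t` acting classically on a `C²` function `φ`:
`H_t(φ)(x) = −div_x F − ⟨∂_z F, ∇φ⟩ − tr(D_pF · D²φ) + F₀`, all evaluated at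
`(x, φ(x), ∇φ(x))`. -/
def Hop (F : Eucl n → ℝ → Eucl n → Eucl n) (F₀ : Eucl n → ℝ → Eucl n → ℝ)
    (φ : Eucl n → ℝ) (x : Eucl n) : ℝ :=
  - divx F x (φ x) (gradient φ x)
    - ⟪deriv (fun s : ℝ => F x s (gradient φ x)) (φ x), gradient φ x⟫_ℝ
    - ∑ i : Fin (n + 1),
        ⟪fderiv ℝ (F x (φ x)) (gradient φ x)
          (fderiv ℝ (gradient φ) x (EuclideanSpace.single i 1)), EuclideanSpace.single i 1⟫_ℝ
    + F₀ x (φ x) (gradient φ x)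

/-- The admissible class `A_g` for the thin obstacle problem: `W^{1,∞}(B₁)` functions
with boundary value `g` on `∂B₁` which are nonnegative on `B₁'`. -/
def AdmissibleThin (g v : Eucl n → ℝ) : Prop :=
  (∃ C : ℝ≥0, LipschitzOnWith C v (Metric.closedBall (0 : Eucl n) 1)) ∧
    (∀ x ∈ Metric.sphere (0 : Eucl n) 1, v x = g x) ∧
    ∀ x ∈ tBall (0 : Eucl n) 1, 0 ≤ v x

/-- A (Lipschitz) solution of the thin obstacle problem in `B₁`. -/
def ThinSolution (F : Eucl n → ℝ → Eucl n → Eucl n) (F₀ : Eucl n → ℝ → Eucl n → ℝ)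
    (g u : Eucl n → ℝ) : Prop :=
  AdmissibleThin g u ∧
    ∀ v : Eucl n → ℝ, AdmissibleThin g v →
      0 ≤ ∫ x in Metric.ball (0 : Eucl n) 1,
        (⟪F x (u x) (gradient u x), gradient v x - gradient u x⟫_ℝ +
          F₀ x (u x) (gradient u x) * (v x - u x))

/-- The admissible class `A_g` for the boundary (Signorini) obstacle problem:
`W^{1,∞}(B₁⁺)` functions with boundary value `g` on `∂B₁⁺ ∖ B₁'` which are
nonnegative on `B₁'`. -/
def AdmissibleBdry (g v : Eucl n → ℝ) : Prop :=
  (∃ C : ℝ≥0, LipschitzOnWith C v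
      (Metric.closedBall (0 : Eucl n) 1 ∩ {x : Eucl n | 0 ≤ x (Fin.last n)})) ∧
    (∀ x : Eucl n, ‖x‖ = 1 → 0 ≤ x (Fin.last n) → v x = g x) ∧
    ∀ x ∈ tBall (0 : Eucl n) 1, 0 ≤ v x

/-- A (Lipschitz) solution of the boundary (Signorini) obstacle problem in `B₁⁺`. -/
def BdrySolution (F : Eucl n → ℝ → Eucl n → Eucl n) (F₀ : Eucl n → ℝ → Eucl n → ℝ)
    (g u : Eucl n → ℝ) : Prop :=
  AdmissibleBdry g u ∧
    ∀ v : Eucl n → ℝ, AdmissibleBdry g v →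
      0 ≤ ∫ x in hBall (0 : Eucl n) 1,
        (⟪F x (u x) (gradient u x), gradient v x - gradient u x⟫_ℝ +
          F₀ x (u x) (gradient u x) * (v x - u x))

/-- The coincidence set `Λ(u) = {x ∈ B₁' : u(x) = 0}`. -/
def coincidenceSet (u : Eucl n → ℝ) : Set (Eucl n) :=
  {x ∈ tBall (0 : Eucl n) 1 | u x = 0}

/-- The free boundary `Γ(u)`: the boundary of `Λ(u)` in the relative topology of `B₁'`. -/
def freeBoundary (u : Eucl n → ℝ) : Set (Eucl n) :=
  {x ∈ coincidenceSet u |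
    ∀ r : ℝ, 0 < r → ∃ y ∈ tBall (0 : Eucl n) 1, y ∈ Metric.ball x r ∧ 0 < u y}

/-- `w` satisfies the Caccioppoli inequality with constant `Q` at `x₀ ∈ B₁'`. -/
def CaccAt (w : Eucl n → ℝ) (Q : ℝ) (x₀ : Eucl n) : Prop :=
  ∀ k : ℝ, 0 ≤ k → ∀ r R : ℝ, 0 < r → r < R → R < 1 - ‖x₀‖ →
    (∫ x in ({x : Eucl n | k ≤ w x} ∩ hBall x₀ r), ‖gradient w x‖ ^ 2) ≤
      Q / (R - r) ^ 2 * (∫ x in ({x : Eucl n | k ≤ w x} ∩ hBall x₀ R), (w x - k) ^ 2) +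
        Q * (volume ({x : Eucl n | k ≤ w x} ∩ hBall x₀ R)).toReal

/-- Difference quotient `D_e^h w (x) = (w(x + h e) − w(x))/h`. -/
def diffQuot (h : ℝ) (e : Eucl n) (w : Eucl n → ℝ) (x : Eucl n) : ℝ :=
  (w (x + h • e) - w x) / h

/-- The barrier function `η(x) = t(|x' − x₀'|² − K x_{n+1}²) + m x_{n+1} + γ`. -/
def etaFn (x₀ : Eucl n) (t K m γ : ℝ) (x : Eucl n) : ℝ :=
  t * ((∑ i : Fin n, (x i.castSucc - x₀ i.castSucc) ^ 2) - K * (x (Fin.last n)) ^ 2) +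
    m * x (Fin.last n) + γ

end TOP

namespace TOP

variable {n : ℕ}

lemma gradient_eq_zero_of_nonneg {φ : Eucl n → ℝ} (h0 : ∀ x, 0 ≤ φ x) {x : Eucl n}
    (hx : φ x = 0) : gradient φ x = 0 := by
  have : IsLocalMin φ x := Filter.Eventually.of_forall fun y => by rw [hx]; exact h0 y
  simp [gradient, this.fderiv_eq_zero]

/-- Integration by parts of a `C¹` vector field on the unit ball against a nonnegative Lipschitz
function supported in a smaller ball. -/
lemma integral_inner_gradient {X : Eucl n → Eucl n} (hX : ContDiffOn ℝ 1 X (ball 0 1))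
    {φ : Eucl n → ℝ} {C : ℝ≥0} (hφ : LipschitzWith C φ) (h0 : ∀ x, 0 ≤ φ x)
    (hs : ∀ x, 3 / 4 ≤ ‖x‖ → φ x = 0) :
    ∫ x in ball (0 : Eucl n) 1, ⟪X x, gradient φ x⟫_ℝ =
      - ∫ x in ball (0 : Eucl n) 1,
        (∑ i, fderiv ℝ X x (EuclideanSpace.single i 1) i) * φ x := by
  let χ : ContDiffBump (0 : Eucl n) := ⟨3 / 4, 7 / 8, by norm_num, by norm_num⟩
  set Y : Eucl n → Eucl n := fun x => χ x • X x with hYdef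
  have hYz : ∀ x, 7 / 8 ≤ ‖x‖ → Y x = 0 := fun x hx => by
    have : χ x = 0 := χ.zero_of_le_dist (by simpa using hx)
    simp [Y, this]
  have hYc : HasCompactSupport Y :=
    HasCompactSupport.intro (isCompact_closedBall (0 : Eucl n) (7 / 8)) fun x hx =>
      hYz x (by simp at hx; exact hx.le)
  have hY : ContDiff ℝ 1 Y := by
    rw [contDiff_iff_contDiffAt]
    intro x
    by_cases hx : ‖x‖ < 1
    · exact χ.contDiff.contDiffAt.smul
        (hX.contDiffAt (isOpen_ball.mem_nhds (by simpa using hx)))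
    · have : Y =ᶠ[𝓝 x] fun _ => 0 := by
        have ho : IsOpen {y : Eucl n | 7 / 8 < ‖y‖} := isOpen_lt continuous_const continuous_norm
        filter_upwards [ho.mem_nhds (show (7 / 8 : ℝ) < ‖x‖ by linarith)] with y hy
        exact hYz y (le_of_lt hy)
      exact contDiffAt_const.congr_of_eventuallyEq this
  have hYX : ∀ x, φ x ≠ 0 → Y =ᶠ[𝓝 x] X := fun x hx => by
    have hx' : ‖x‖ < 3 / 4 := by
      by_contra! h
      exact hx (hs x h)
    filter_upwards [isOpen_ball.mem_nhds (show x ∈ ball (0 : Eucl n) (3 / 4) by simpa using hx')]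
      with y hy
    have : χ y = 1 := χ.one_of_mem_closedBall (ball_subset_closedBall hy)
    simp [Y, this]
  have hcoord : ∀ i, ContDiff ℝ 1 (fun x => Y x i) := fun i =>
    (EuclideanSpace.proj (𝕜 := ℝ) i).contDiff.comp hY
  have hcoordc : ∀ i, HasCompactSupport (fun x => Y x i) := fun i =>
    hYc.comp_left (g := fun v : Eucl n => v i) (by simp)
  have hYd : ∀ x, DifferentiableAt ℝ Y x := fun x => hY.differentiable one_ne_zero x
  have hline : ∀ i x, lineDeriv ℝ (fun x => Y x i) x (-EuclideanSpace.single i 1) =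
      - fderiv ℝ Y x (EuclideanSpace.single i 1) i := fun i x => by
    rw [((hcoord i).differentiable one_ne_zero x).lineDeriv_eq_fderiv]
    have : HasFDerivAt (fun x => Y x i) ((EuclideanSpace.proj (𝕜 := ℝ) i).comp (fderiv ℝ Y x)) x :=
      (EuclideanSpace.proj (𝕜 := ℝ) i).hasFDerivAt.comp x (hYd x).hasFDerivAt
    rw [this.fderiv]
    simp
  have hL : ∫ x in ball (0 : Eucl n) 1, ⟪X x, gradient φ x⟫_ℝ = ∫ x, ⟪Y x, gradient φ x⟫_ℝ := by
    have h1 : ∀ x, ⟪X x, gradient φ x⟫_ℝ = ⟪Y x, gradient φ x⟫_ℝ := fun x => by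
      by_cases hx : φ x = 0
      · simp [gradient_eq_zero_of_nonneg h0 hx]
      · rw [(hYX x hx).eq_of_nhds]
    simp_rw [h1]
    refine setIntegral_eq_integral_of_forall_compl_eq_zero fun x hx => ?_
    rw [hYz x (by simp at hx; linarith), inner_zero_left]
  have hR : ∫ x in ball (0 : Eucl n) 1,
        (∑ i, fderiv ℝ X x (EuclideanSpace.single i 1) i) * φ x =
      ∫ x, (∑ i, fderiv ℝ Y x (EuclideanSpace.single i 1) i) * φ x := by
    have h1 : ∀ x, (∑ i, fderiv ℝ X x (EuclideanSpace.single i 1) i) * φ x =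
        (∑ i, fderiv ℝ Y x (EuclideanSpace.single i 1) i) * φ x := fun x => by
      by_cases hx : φ x = 0
      · simp [hx]
      · rw [(hYX x hx).fderiv_eq]
    simp_rw [h1]
    refine setIntegral_eq_integral_of_forall_compl_eq_zero fun x hx => ?_
    rw [hs x (by simp at hx; linarith), mul_zero]
  rw [hL, hR]
  have h2 : ∀ᵐ x, ⟪Y x, gradient φ x⟫_ℝ =
      ∑ i, lineDeriv ℝ φ x (EuclideanSpace.single i 1) * Y x i := by
    filter_upwards [hφ.ae_differentiableAt] with x hx
    rw [real_inner_comm, inner_gradient_left]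
    conv_lhs => rw [← (EuclideanSpace.basisFun (Fin (n + 1)) ℝ).sum_repr (Y x)]
    simp [hx.lineDeriv_eq_fderiv, mul_comm]
  rw [integral_congr_ae h2, integral_finsetSum]
  · have h3 : ∀ i, ∫ x, lineDeriv ℝ φ x (EuclideanSpace.single i 1) * Y x i =
        ∫ x, - (fderiv ℝ Y x (EuclideanSpace.single i 1) i * φ x) := fun i => by
      obtain ⟨D, hD⟩ := (hcoord i).lipschitzWith_of_hasCompactSupport (hcoordc i) one_ne_zero
      rw [hφ.integral_lineDeriv_mul_eq hD (hcoordc i)]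
      simp_rw [hline, neg_mul]
    simp_rw [h3]
    rw [← integral_finsetSum, ← integral_neg]
    · simp_rw [Finset.sum_neg_distrib, Finset.sum_mul]
    · intro i _
      have hc : Continuous fun x => fderiv ℝ Y x (EuclideanSpace.single i 1) i :=
        (EuclideanSpace.proj (𝕜 := ℝ) i).continuous.comp
          ((hY.continuous_fderiv one_ne_zero).clm_apply continuous_const)
      refine ((hc.mul hφ.continuous).integrable_of_hasCompactSupport ?_).neg
      exact HasCompactSupport.mul_left (HasCompactSupport.intro
        (isCompact_closedBall (0 : Eucl n) (3 / 4)) fun x hx =>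
          hs x (by simp at hx; exact hx.le))
  · intro i _
    exact ((hcoord i).continuous.integrable_of_hasCompactSupport (hcoordc i)).mul_of_top_right
      (hφ.memLp_lineDeriv _)

/-- Extension by zero of a Lipschitz function on the unit ball supported in a smaller ball. -/
lemma exists_lipschitzWith_extend_zero {f : Eucl n → ℝ} {C : ℝ≥0}
    (hf : LipschitzOnWith C f (closedBall 0 1))
    (hs : ∀ x ∈ closedBall (0 : Eucl n) 1, 3 / 4 ≤ ‖x‖ → f x = 0) :
    ∃ D : ℝ≥0, LipschitzWith D ((closedBall (0 : Eucl n) 1).indicator f) := by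
  obtain ⟨A, hA⟩ := (isCompact_closedBall (0 : Eucl n) 1).exists_bound_of_continuousOn
    hf.continuousOn
  have hA0 : 0 ≤ A := (norm_nonneg _).trans (hA 0 (by simp))
  have key : ∀ x y : Eucl n, x ∈ closedBall (0 : Eucl n) 1 → y ∉ closedBall (0 : Eucl n) 1 →
      |f x| ≤ 4 * A * dist x y := fun x y hx hy => by
    by_cases h : 3 / 4 ≤ ‖x‖
    · rw [hs x hx h, abs_zero]
      positivity
    · have h1 : ‖y‖ - ‖x‖ ≤ dist x y := by
        rw [dist_comm, dist_eq_norm]; exact norm_sub_norm_le y x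
      have h2 : 1 < ‖y‖ := by simpa using hy
      have h3 : |f x| ≤ A := hA x hx
      push Not at h
      nlinarith
  refine ⟨C + 4 * A.toNNReal, LipschitzWith.of_dist_le_mul fun x y => ?_⟩
  have hD : ((C + 4 * A.toNNReal : ℝ≥0) : ℝ) = C + 4 * A := by simp [hA0]
  rw [hD, Real.dist_eq]
  have hC : 0 ≤ (C : ℝ) * dist x y := by positivity
  have hAd : 0 ≤ 4 * A * dist x y := by positivity
  by_cases hx : x ∈ closedBall (0 : Eucl n) 1 <;> by_cases hy : y ∈ closedBall (0 : Eucl n) 1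
  · rw [Set.indicator_of_mem hx, Set.indicator_of_mem hy]
    have := hf.dist_le_mul x hx y hy
    rw [Real.dist_eq] at this
    linarith
  · rw [Set.indicator_of_mem hx, Set.indicator_of_notMem hy, sub_zero]
    have := key x y hx hy
    linarith
  · rw [Set.indicator_of_notMem hx, Set.indicator_of_mem hy, zero_sub, abs_neg]
    have := key y x hy hx
    rw [dist_comm] at this
    linarith
  · rw [Set.indicator_of_notMem hx, Set.indicator_of_notMem hy]
    simp only [sub_self, abs_zero]
    linarith

lemma H0.contDiffAt {F : Eucl n → ℝ → Eucl n → Eucl n} {F₀ : Eucl n → ℝ → Eucl n → ℝ}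
    (h : H0 F F₀) {x : Eucl n} (hx : x ∈ ball (0 : Eucl n) 1) (z : ℝ) (p : Eucl n) :
    ContDiffAt ℝ 1 (fun q : Eucl n × ℝ × Eucl n => F q.1 q.2.1 q.2.2) (x, z, p) :=
  h.1.contDiffAt ((isOpen_ball.prod (isOpen_univ.prod isOpen_univ)).mem_nhds
    (by simpa using hx))

lemma H0.hasFDerivAt_p {F : Eucl n → ℝ → Eucl n → Eucl n} {F₀ : Eucl n → ℝ → Eucl n → ℝ}
    (h : H0 F F₀) {x : Eucl n} (hx : x ∈ ball (0 : Eucl n) 1) (z : ℝ) (p : Eucl n) :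
    HasFDerivAt (F x z)
      ((fderiv ℝ (fun q : Eucl n × ℝ × Eucl n => F q.1 q.2.1 q.2.2) (x, z, p)).comp
        ((0 : Eucl n →L[ℝ] Eucl n).prod
          ((0 : Eucl n →L[ℝ] ℝ).prod (ContinuousLinearMap.id ℝ (Eucl n))))) p :=
  HasFDerivAt.comp (f := fun p : Eucl n => (x, z, p)) p
    ((h.contDiffAt hx z p).differentiableAt one_ne_zero).hasFDerivAt
    ((hasFDerivAt_const x p).prodMk ((hasFDerivAt_const z p).prodMk (hasFDerivAt_id p)))

/-- Ellipticity gives strong monotonicity of `p ↦ F x z p` on balls. -/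
lemma inner_sub_ge {F : Eucl n → ℝ → Eucl n → Eucl n} {F₀ : Eucl n → ℝ → Eucl n → ℝ}
    {lam : ℝ → ℝ} (h0 : H0 F F₀) (h1 : H1With lam F) {M : ℝ} (hM : 0 < M)
    {x : Eucl n} (hx : x ∈ ball (0 : Eucl n) 1) {z : ℝ} (hz : |z| ≤ M) {p q : Eucl n}
    (hp : ‖p‖ ≤ M) (hq : ‖q‖ ≤ M) :
    lam M * ‖p - q‖ ^ 2 ≤ ⟪F x z p - F x z q, p - q⟫_ℝ := by
  set f : ℝ → ℝ := fun s => ⟪F x z (q + s • (p - q)), p - q⟫_ℝ with hf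
  have hd : ∀ s, HasDerivAt f
      ⟪fderiv ℝ (F x z) (q + s • (p - q)) (p - q), p - q⟫_ℝ s := fun s => by
    have hl : HasDerivAt (fun s : ℝ => q + s • (p - q)) (p - q) s := by
      simpa using ((hasDerivAt_id s).smul_const (p - q)).const_add q
    have hF := (h0.hasFDerivAt_p hx z (q + s • (p - q))).differentiableAt.hasFDerivAt
    simpa using (hF.comp_hasDerivAt s hl).inner ℝ (hasDerivAt_const s (p - q))
  have hmv := (convex_Icc (0 : ℝ) 1).mul_sub_le_image_sub_of_le_deriv (f := f)
    (fun s _ => (hd s).continuousAt.continuousWithinAt)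
    (fun s _ => (hd s).differentiableAt.differentiableWithinAt)
    (C := lam M * ‖p - q‖ ^ 2) (fun s hs => ?_) 0 (by simp) 1 (by simp) zero_le_one
  · simpa [hf, inner_sub_left] using hmv
  · rw [(hd s).deriv]
    refine (h1 M hM).2 x hx z hz _ ?_ _
    have hs' := interior_subset hs
    have hc := (convex_closedBall (0 : Eucl n) M).add_smul_sub_mem (x := q) (y := p)
      (by simpa using hq) (by simpa using hp) hs'
    simpa using hc

lemma contDiff_gradient {ψ : Eucl n → ℝ} (hψ : ContDiff ℝ 2 ψ) :
    ContDiff ℝ 1 (gradient ψ) :=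
  (InnerProductSpace.toDual ℝ (Eucl n)).symm.contDiff.comp
    (hψ.fderiv_right (m := 1) (by norm_num))

lemma contDiffOn_field {F : Eucl n → ℝ → Eucl n → Eucl n} {F₀ : Eucl n → ℝ → Eucl n → ℝ}
    (h0 : H0 F F₀) {ψ : Eucl n → ℝ} (hψ : ContDiff ℝ 2 ψ) :
    ContDiffOn ℝ 1 (fun x => F x (ψ x) (gradient ψ x)) (ball 0 1) :=
  h0.1.comp (f := fun x => (x, ψ x, gradient ψ x))
    (contDiff_id.prodMk ((hψ.of_le (by norm_num)).prodMk (contDiff_gradient hψ))).contDiffOn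
    fun x hx => by simpa using hx

/-- The classical operator is the divergence-form operator. -/
lemma hop_eq {F : Eucl n → ℝ → Eucl n → Eucl n} {F₀ : Eucl n → ℝ → Eucl n → ℝ}
    (h0 : H0 F F₀) {ψ : Eucl n → ℝ} (hψ : ContDiff ℝ 2 ψ) {x : Eucl n}
    (hx : x ∈ ball (0 : Eucl n) 1) :
    Hop F F₀ ψ x = - (∑ i, fderiv ℝ (fun x => F x (ψ x) (gradient ψ x)) x
      (EuclideanSpace.single i 1) i) + F₀ x (ψ x) (gradient ψ x) := by
  set G : Eucl n × ℝ × Eucl n → Eucl n := fun q => F q.1 q.2.1 q.2.2 with hG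
  set z := ψ x with hz
  set p := gradient ψ x with hp
  set D := fderiv ℝ G (x, z, p) with hDdef
  have hD : HasFDerivAt G D (x, z, p) :=
    ((h0.contDiffAt hx z p).differentiableAt one_ne_zero).hasFDerivAt
  have hψ' : HasFDerivAt ψ (fderiv ℝ ψ x) x := (hψ.differentiable two_ne_zero x).hasFDerivAt
  have hg' : HasFDerivAt (gradient ψ) (fderiv ℝ (gradient ψ) x) x :=
    ((contDiff_gradient hψ).differentiable one_ne_zero x).hasFDerivAt
  have hX : HasFDerivAt (fun x => F x (ψ x) (gradient ψ x))
      (D.comp ((ContinuousLinearMap.id ℝ (Eucl n)).prod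
        ((fderiv ℝ ψ x).prod (fderiv ℝ (gradient ψ) x)))) x :=
    HasFDerivAt.comp (f := fun x => (x, ψ x, gradient ψ x)) x hD
      ((hasFDerivAt_id x).prodMk (hψ'.prodMk hg'))
  have h1 : ∀ i, fderiv ℝ (fun y : Eucl n => F y z p i) x (EuclideanSpace.single i 1) =
      D (EuclideanSpace.single i 1, 0, 0) i := fun i => by
    have : HasFDerivAt (fun y : Eucl n => F y z p)
        (D.comp ((ContinuousLinearMap.id ℝ (Eucl n)).prod
          ((0 : Eucl n →L[ℝ] ℝ).prod (0 : Eucl n →L[ℝ] Eucl n)))) x :=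
      HasFDerivAt.comp (f := fun y : Eucl n => (y, z, p)) x hD
        ((hasFDerivAt_id x).prodMk ((hasFDerivAt_const z x).prodMk (hasFDerivAt_const p x)))
    have h := (EuclideanSpace.proj (𝕜 := ℝ) i).hasFDerivAt.comp x this
    have h' : HasFDerivAt (fun y : Eucl n => F y z p i) _ x := h
    rw [h'.fderiv]
    simp
  have h2 : deriv (fun s : ℝ => F x s p) z = D (0, 1, 0) :=
    (HasFDerivAt.comp_hasDerivAt (f := fun s : ℝ => (x, s, p)) z hD
      ((hasDerivAt_const z x).prodMk ((hasDerivAt_id z).prodMk (hasDerivAt_const z p)))).deriv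
  have h3 : ∀ v, fderiv ℝ (F x z) p v = D (0, 0, v) := fun v => by
    rw [(h0.hasFDerivAt_p hx z p).fderiv]
    simp [hDdef, hG]
  have h4 : ⟪D (0, 1, 0), p⟫_ℝ =
      ∑ i, (fderiv ℝ ψ x (EuclideanSpace.single i 1)) * D (0, 1, 0) i := by
    rw [PiLp.inner_apply]
    refine Finset.sum_congr rfl fun i _ => ?_
    rw [← inner_gradient_left (𝕜 := ℝ), ← hp, EuclideanSpace.inner_single_right]
    simp
  have h5 : ∀ i, D (EuclideanSpace.single i 1, fderiv ℝ ψ x (EuclideanSpace.single i 1),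
      fderiv ℝ (gradient ψ) x (EuclideanSpace.single i 1)) i =
      D (EuclideanSpace.single i 1, 0, 0) i +
      (fderiv ℝ ψ x (EuclideanSpace.single i 1)) * D (0, 1, 0) i +
      D (0, 0, fderiv ℝ (gradient ψ) x (EuclideanSpace.single i 1)) i := fun i => by
    have : ((EuclideanSpace.single i 1, fderiv ℝ ψ x (EuclideanSpace.single i 1),
      fderiv ℝ (gradient ψ) x (EuclideanSpace.single i 1)) : Eucl n × ℝ × Eucl n) =
      (EuclideanSpace.single i 1, 0, 0) +
      (fderiv ℝ ψ x (EuclideanSpace.single i 1)) • (0, 1, 0) +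
      (0, 0, fderiv ℝ (gradient ψ) x (EuclideanSpace.single i 1)) := by
      simp
    rw [this, map_add, map_add, map_smul]
    simp
  rw [Hop, divx, hX.fderiv]
  simp only [← hz, ← hp, h1, h2, h3, h4]
  simp only [ContinuousLinearMap.comp_apply, ContinuousLinearMap.prod_apply,
    ContinuousLinearMap.id_apply, h5, Finset.sum_add_distrib, EuclideanSpace.inner_single_right]
  simp
  ring

lemma integrableOn_ball_of_bound {w : Eucl n → ℝ}
    (hw : AEMeasurable w (volume.restrict (ball 0 1))) {A : ℝ} (hA0 : 0 ≤ A)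
    (hA : ∀ x, ‖x‖ < 3 / 4 → |w x| ≤ A) (hs : ∀ x, 3 / 4 ≤ ‖x‖ → w x = 0) :
    IntegrableOn w (ball 0 1) := by
  have : IsFiniteMeasure (volume.restrict (ball (0 : Eucl n) 1)) :=
    isFiniteMeasure_restrict.2 measure_ball_lt_top.ne
  refine Integrable.of_bound hw.aestronglyMeasurable A (Filter.Eventually.of_forall fun x => ?_)
  by_cases hx : ‖x‖ < 3 / 4
  · exact hA x hx
  · rw [hs x (not_lt.1 hx), norm_zero]
    exact hA0

lemma aemeasurable_comp_of_continuousOn {E : Type*} [TopologicalSpace E] [MeasurableSpace E]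
    [BorelSpace E] [Zero E] {G : Eucl n × ℝ × Eucl n → E}
    (hG : ContinuousOn G (ball (0 : Eucl n) 1 ×ˢ (Set.univ : Set ℝ) ×ˢ (Set.univ : Set (Eucl n))))
    {z : Eucl n → ℝ} {p : Eucl n → Eucl n}
    (hz : AEMeasurable z (volume.restrict (ball 0 1)))
    (hp : AEMeasurable p (volume.restrict (ball 0 1))) :
    AEMeasurable (fun x => G (x, z x, p x)) (volume.restrict (ball 0 1)) := by
  classical
  have hm : Measurable
      ((ball (0 : Eucl n) 1 ×ˢ (Set.univ : Set ℝ) ×ˢ (Set.univ : Set (Eucl n))).piecewise G 0) :=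
    hG.measurable_piecewise continuousOn_const
      (measurableSet_ball.prod (MeasurableSet.univ.prod MeasurableSet.univ))
  refine (hm.comp_aemeasurable (aemeasurable_id.prodMk (hz.prodMk hp))).congr ?_
  filter_upwards [ae_restrict_mem measurableSet_ball] with x hx
  simp only [Function.comp_apply, id]
  rw [Set.piecewise_eq_of_mem]
  simpa using hx

/-- The compact set of arguments `(x, z, p)` seen by functions bounded in `C¹` by `M`. -/
def argSet (n : ℕ) (M : ℝ) : Set (Eucl n × ℝ × Eucl n) :=
  closedBall (0 : Eucl n) (3 / 4) ×ˢ Set.Icc (-M) M ×ˢ closedBall (0 : Eucl n) M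

lemma mem_argSet {M : ℝ} {x : Eucl n} {z : ℝ} {p : Eucl n} :
    (x, z, p) ∈ argSet n M ↔ ‖x‖ ≤ 3 / 4 ∧ |z| ≤ M ∧ ‖p‖ ≤ M := by
  simp [argSet, abs_le]

lemma isCompact_argSet (M : ℝ) : IsCompact (argSet n M) :=
  (isCompact_closedBall _ _).prod (isCompact_Icc.prod (isCompact_closedBall _ _))

lemma convex_argSet (M : ℝ) : Convex ℝ (argSet n M) :=
  (convex_closedBall _ _).prod ((convex_Icc _ _).prod (convex_closedBall _ _))

lemma argSet_subset (M : ℝ) : argSet n M ⊆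
    ball (0 : Eucl n) 1 ×ˢ (Set.univ : Set ℝ) ×ˢ (Set.univ : Set (Eucl n)) := fun q hq => by
  have := hq.1
  simp only [mem_closedBall, dist_zero_right] at this
  simp only [Set.mem_prod, mem_ball, dist_zero_right, Set.mem_univ, and_true]
  linarith

lemma exists_bound_comp_of_continuousOn {E : Type*} [SeminormedAddCommGroup E]
    {G : Eucl n × ℝ × Eucl n → E}
    (hG : ContinuousOn G (ball (0 : Eucl n) 1 ×ˢ (Set.univ : Set ℝ) ×ˢ (Set.univ : Set (Eucl n))))
    {z : Eucl n → ℝ} {p : Eucl n → Eucl n} {M : ℝ}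
    (hz : ∀ x, ‖x‖ < 3 / 4 → |z x| ≤ M) (hp : ∀ x, ‖x‖ < 3 / 4 → ‖p x‖ ≤ M) :
    ∃ A : ℝ, 0 ≤ A ∧ ∀ x, ‖x‖ < 3 / 4 → ‖G (x, z x, p x)‖ ≤ A := by
  obtain ⟨A, hA⟩ := (isCompact_argSet M).exists_bound_of_continuousOn
    (hG.mono (argSet_subset M))
  have h : ∀ x, ‖x‖ < 3 / 4 → ‖G (x, z x, p x)‖ ≤ A := fun x hx =>
    hA _ (mem_argSet.2 ⟨hx.le, hz x hx, hp x hx⟩)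
  exact ⟨A, (norm_nonneg _).trans (h 0 (by simp)), h⟩

lemma measurable_gradient (f : Eucl n → ℝ) : Measurable (gradient f) :=
  (InnerProductSpace.toDual ℝ (Eucl n)).symm.continuous.measurable.comp (measurable_fderiv ℝ f)

lemma norm_gradient (f : Eucl n → ℝ) (x : Eucl n) : ‖gradient f x‖ = ‖fderiv ℝ f x‖ := by
  simp [gradient]

lemma integrableOn_pairing {F : Eucl n → ℝ → Eucl n → Eucl n} {F₀ : Eucl n → ℝ → Eucl n → ℝ}
    (h0 : H0 F F₀) {φ : Eucl n → ℝ} {D : ℝ≥0} (hφ : LipschitzWith D φ) (hφ0 : ∀ x, 0 ≤ φ x)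
    (hs : ∀ x, 3 / 4 ≤ ‖x‖ → φ x = 0) {σ : ℝ} (hσ : ∀ x, φ x ≤ σ)
    {z : Eucl n → ℝ} {p : Eucl n → Eucl n}
    (hz : AEMeasurable z (volume.restrict (ball 0 1)))
    (hp : AEMeasurable p (volume.restrict (ball 0 1))) {M : ℝ}
    (hzM : ∀ x, ‖x‖ < 3 / 4 → |z x| ≤ M) (hpM : ∀ x, ‖x‖ < 3 / 4 → ‖p x‖ ≤ M) :
    IntegrableOn (fun x => ⟪F x (z x) (p x), gradient φ x⟫_ℝ) (ball 0 1) ∧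
      IntegrableOn (fun x => F₀ x (z x) (p x) * φ x) (ball 0 1) := by
  obtain ⟨A, hA0, hF⟩ := exists_bound_comp_of_continuousOn h0.1.continuousOn hzM hpM
  obtain ⟨A₀, hA₀0, hF₀⟩ := exists_bound_comp_of_continuousOn h0.2.continuousOn hzM hpM
  have hσ0 : 0 ≤ σ := (hφ0 0).trans (hσ 0)
  constructor
  · refine integrableOn_ball_of_bound (A := A * D) ?_ (by positivity) (fun x hx => ?_)
      fun x hx => ?_
    · have hm :=
        aemeasurable_comp_of_continuousOn h0.1.continuousOn hz hp
      exact hm.inner (measurable_gradient φ).aemeasurable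
    · refine (abs_real_inner_le_norm _ _).trans ?_
      refine mul_le_mul (hF x hx) ?_ (norm_nonneg _) hA0
      rw [norm_gradient]
      exact norm_fderiv_le_of_lipschitz ℝ hφ
    · simp [gradient_eq_zero_of_nonneg hφ0 (hs x hx)]
  · refine integrableOn_ball_of_bound (A := A₀ * σ) ?_ (by positivity) (fun x hx => ?_)
      fun x hx => ?_
    · have hm :=
        aemeasurable_comp_of_continuousOn h0.2.continuousOn hz hp
      exact hm.mul hφ.continuous.measurable.aemeasurable
    · rw [abs_mul, abs_of_nonneg (hφ0 x)]
      exact mul_le_mul (hF₀ x hx) (hσ x) (hφ0 x) hA₀0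
    · simp [hs x hx]

/-- A strict classical supersolution dominates itself in the weak sense. -/
lemma supersolution_weak {F : Eucl n → ℝ → Eucl n → Eucl n} {F₀ : Eucl n → ℝ → Eucl n → ℝ}
    (h0 : H0 F F₀) {ψ : Eucl n → ℝ} (hψ : ContDiff ℝ 2 ψ) {c : ℝ}
    (hsup : ∀ x ∈ ball (0 : Eucl n) 1, c ≤ Hop F F₀ ψ x)
    {φ : Eucl n → ℝ} {D : ℝ≥0} (hφ : LipschitzWith D φ) (hφ0 : ∀ x, 0 ≤ φ x)
    (hs : ∀ x, 3 / 4 ≤ ‖x‖ → φ x = 0) {σ : ℝ} (hσ : ∀ x, φ x ≤ σ) {M : ℝ}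
    (hzM : ∀ x, ‖x‖ < 3 / 4 → |ψ x| ≤ M) (hpM : ∀ x, ‖x‖ < 3 / 4 → ‖gradient ψ x‖ ≤ M) :
    c * ∫ x in ball (0 : Eucl n) 1, φ x ≤ ∫ x in ball (0 : Eucl n) 1,
      (⟪F x (ψ x) (gradient ψ x), gradient φ x⟫_ℝ + F₀ x (ψ x) (gradient ψ x) * φ x) := by
  obtain ⟨hi1, hi2⟩ := integrableOn_pairing h0 hφ hφ0 hs hσ
    hψ.continuous.measurable.aemeasurable (measurable_gradient ψ).aemeasurable hzM hpM
  have hX := contDiffOn_field h0 hψ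
  have hdiv : ContinuousOn (fun x => ∑ i, fderiv ℝ (fun x => F x (ψ x) (gradient ψ x)) x
      (EuclideanSpace.single i 1) i) (ball (0 : Eucl n) 1) := by
    refine continuousOn_finsetSum _ fun i _ => ?_
    exact (EuclideanSpace.proj (𝕜 := ℝ) i).continuous.comp_continuousOn
      ((hX.continuousOn_fderiv_of_isOpen isOpen_ball le_rfl).clm_apply continuousOn_const)
  have hi3 : IntegrableOn (fun x => (∑ i, fderiv ℝ (fun x => F x (ψ x) (gradient ψ x)) x
      (EuclideanSpace.single i 1) i) * φ x) (ball (0 : Eucl n) 1) := by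
    obtain ⟨A, hA⟩ := (isCompact_closedBall (0 : Eucl n) (3 / 4)).exists_bound_of_continuousOn
      (hdiv.mono (closedBall_subset_ball (by norm_num)))
    have hA0 : 0 ≤ A := (norm_nonneg _).trans (hA 0 (by simp; norm_num))
    refine integrableOn_ball_of_bound (A := A * σ) ?_
      (mul_nonneg hA0 ((hφ0 0).trans (hσ 0))) (fun x hx => ?_) fun x hx => by simp [hs x hx]
    · exact (hdiv.aemeasurable measurableSet_ball).mul hφ.continuous.measurable.aemeasurable
    · rw [abs_mul, abs_of_nonneg (hφ0 x)]
      exact mul_le_mul (hA x (by simpa using hx.le)) (hσ x) (hφ0 x) hA0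
  have hiφ : IntegrableOn φ (ball (0 : Eucl n) 1) :=
    integrableOn_ball_of_bound hφ.continuous.measurable.aemeasurable ((hφ0 0).trans (hσ 0))
      (fun x _ => by rw [abs_of_nonneg (hφ0 x)]; exact hσ x) hs
  rw [integral_add hi1 hi2, integral_inner_gradient hX hφ hφ0 hs, ← integral_const_mul,
    ← integral_neg, ← integral_add (Integrable.fun_neg hi3) hi2]
  refine setIntegral_mono_on (hiφ.const_mul c) ((Integrable.fun_neg hi3).add hi2) measurableSet_ball fun x hx => ?_
  have := mul_le_mul_of_nonneg_right (hsup x hx) (hφ0 x)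
  rw [hop_eq h0 hψ hx] at this
  linarith

/-- Ellipticity up to a quadratic zeroth-order error. -/
lemma exists_neg_pairing_le {F : Eucl n → ℝ → Eucl n → Eucl n} {F₀ : Eucl n → ℝ → Eucl n → ℝ}
    {lam : ℝ → ℝ} (h0 : H0 F F₀) (h1 : H1With lam F) {M : ℝ} (hM : 0 < M) :
    ∃ B : ℝ, 0 < B ∧ ∀ (x : Eucl n) (z y : ℝ) (p q : Eucl n), ‖x‖ ≤ 3 / 4 → |z| ≤ M → |y| ≤ M →
      ‖p‖ ≤ M → ‖q‖ ≤ M → y ≤ z →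
      - (⟪F x z p, p - q⟫_ℝ + F₀ x z p * (z - y)) ≤
        B * (z - y) ^ 2 - (⟪F x y q, p - q⟫_ℝ + F₀ x y q * (z - y)) := by
  obtain ⟨K, hK⟩ := (h0.1.mono (argSet_subset M)).exists_lipschitzOnWith one_ne_zero
    (convex_argSet M) (isCompact_argSet M)
  obtain ⟨K₀, hK₀⟩ := (h0.2.mono (argSet_subset M)).exists_lipschitzOnWith one_ne_zero
    (convex_argSet M) (isCompact_argSet M)
  have hl : 0 < lam M := (h1 M hM).1
  set C : ℝ := K + K₀ with hC
  have hC0 : 0 ≤ C := by positivity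
  refine ⟨C ^ 2 / lam M + C + 1, by positivity, fun x z y p q hx hz hy hp hq hyz => ?_⟩
  have hmono := inner_sub_ge h0 h1 hM (x := x) (by simp; linarith) hz hp hq
  have hF : ‖F x z q - F x y q‖ ≤ K * (z - y) := by
    have := hK.norm_sub_le (x := (x, z, q)) (y := (x, y, q)) (mem_argSet.2 ⟨hx, hz, hq⟩)
      (mem_argSet.2 ⟨hx, hy, hq⟩)
    simpa [Prod.norm_def, abs_of_nonneg (sub_nonneg.2 hyz), hyz] using this
  have hF₀ : |F₀ x z p - F₀ x y q| ≤ K₀ * ((z - y) + ‖p - q‖) := by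
    have := hK₀.norm_sub_le (x := (x, z, p)) (y := (x, y, q)) (mem_argSet.2 ⟨hx, hz, hp⟩)
      (mem_argSet.2 ⟨hx, hy, hq⟩)
    simp only [Real.norm_eq_abs, Prod.norm_def, Prod.mk_sub_mk, sub_self, norm_zero,
      abs_of_nonneg (sub_nonneg.2 hyz)] at this
    refine this.trans (mul_le_mul_of_nonneg_left ?_ K₀.2)
    have h1 := norm_nonneg (p - q)
    have h2 := sub_nonneg.2 hyz
    exact max_le (by linarith) (max_le (by linarith) (by linarith))
  have hi : -⟪F x z q - F x y q, p - q⟫_ℝ ≤ K * (z - y) * ‖p - q‖ :=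
    (neg_le_abs _).trans ((abs_real_inner_le_norm _ _).trans
      (mul_le_mul_of_nonneg_right hF (norm_nonneg _)))
  set d := ‖p - q‖ with hd
  set s := z - y with hs
  have hd0 : 0 ≤ d := norm_nonneg _
  have hs0 : 0 ≤ s := sub_nonneg.2 hyz
  have hj : -((F₀ x z p - F₀ x y q) * s) ≤ K₀ * (s + d) * s := by
    have := mul_le_mul_of_nonneg_right ((neg_le_abs _).trans hF₀) hs0
    linarith
  have hsplit : ⟪F x z p, p - q⟫_ℝ - ⟪F x y q, p - q⟫_ℝ =
      ⟪F x z p - F x z q, p - q⟫_ℝ + ⟪F x z q - F x y q, p - q⟫_ℝ := by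
    simp only [inner_sub_left]; ring
  have hyoung : 2 * C * s * d - lam M * d ^ 2 ≤ C ^ 2 / lam M * s ^ 2 := by
    have : C ^ 2 / lam M * s ^ 2 - (2 * C * s * d - lam M * d ^ 2) =
        (C * s - lam M * d) ^ 2 / lam M := by
      field_simp
      ring
    have h2 : 0 ≤ (C * s - lam M * d) ^ 2 / lam M := by positivity
    linarith
  have hKs : (K : ℝ) * s * d + K₀ * (s + d) * s ≤ 2 * C * s * d + C * s ^ 2 := by
    have e1 : 0 ≤ (K : ℝ) * (s * d) := by positivity
    have e2 : 0 ≤ (K₀ : ℝ) * (s * d) := by positivity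
    have e3 : 0 ≤ (K : ℝ) * s ^ 2 := by positivity
    rw [hC]
    nlinarith
  nlinarith [sq_nonneg s]

/-- Comparison principle: a solution lies below an obstacle-compatible strict supersolution all of
whose upward shifts are strict supersolutions. -/
lemma ThinSolution.le_of_supersolution {F : Eucl n → ℝ → Eucl n → Eucl n}
    {F₀ : Eucl n → ℝ → Eucl n → ℝ} {lam : ℝ → ℝ} (h0 : H0 F F₀) (h1 : H1With lam F)
    {g u : Eucl n → ℝ} (hu : ThinSolution F F₀ g u) {ψ : Eucl n → ℝ} (hψ : ContDiff ℝ 2 ψ)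
    (hψ0 : ∀ x ∈ tBall (0 : Eucl n) 1, 0 ≤ ψ x) {c : ℝ} (hc : 0 < c)
    (hsup : ∀ γ : ℝ, 0 ≤ γ → γ ≤ 1 → ∀ x ∈ ball (0 : Eucl n) 1,
      c ≤ Hop F F₀ (fun x => ψ x + γ) x)
    (hbd : ∀ x ∈ closedBall (0 : Eucl n) 1, 3 / 4 ≤ ‖x‖ → u x ≤ ψ x)
    (hone : ∀ x ∈ closedBall (0 : Eucl n) 1, u x ≤ ψ x + 1) :
    ∀ x ∈ closedBall (0 : Eucl n) 1, u x ≤ ψ x := by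
  obtain ⟨⟨⟨Ku, hKu⟩, hug, hu0⟩, hvar⟩ := hu
  have hcpt := isCompact_closedBall (0 : Eucl n) 1
  obtain ⟨Kψ, hKψ⟩ := (hψ.contDiffOn (s := closedBall (0 : Eucl n) 1)).exists_lipschitzOnWith
    two_ne_zero (convex_closedBall _ _) hcpt
  by_contra! hcon
  obtain ⟨x₁, hx₁, hx₁'⟩ := hcon
  obtain ⟨y, hy, hmax⟩ := hcpt.exists_isMaxOn ⟨x₁, hx₁⟩ (hKu.sub hKψ).continuousOn
  set N := u y - ψ y with hN
  have hmaxN : ∀ x ∈ closedBall (0 : Eucl n) 1, u x - ψ x ≤ N := fun x hx => hmax hx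
  have hN0 : 0 < N := by have := hmaxN x₁ hx₁; linarith
  have hN1 : N ≤ 1 := by have := hone y hy; linarith
  obtain ⟨M₁, hM₁⟩ := hcpt.exists_bound_of_continuousOn hKu.continuousOn
  obtain ⟨M₂, hM₂⟩ := hcpt.exists_bound_of_continuousOn hψ.continuous.continuousOn
  obtain ⟨M₃, hM₃⟩ := hcpt.exists_bound_of_continuousOn
    (contDiff_gradient hψ).continuous.continuousOn
  have hM₁0 : 0 ≤ M₁ := (norm_nonneg _).trans (hM₁ y hy)
  have hM₂0 : 0 ≤ M₂ := (norm_nonneg _).trans (hM₂ y hy)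
  have hM₃0 : 0 ≤ M₃ := (norm_nonneg _).trans (hM₃ y hy)
  set M : ℝ := M₁ + M₂ + M₃ + Ku + 1 with hM
  have hKu0 : (0 : ℝ) ≤ Ku := Ku.2
  have hM0 : 0 < M := by positivity
  obtain ⟨B, hB, hpt⟩ := exists_neg_pairing_le h0 h1 hM0
  set σ := min N (c / (2 * B)) with hσ
  have hσ0 : 0 < σ := lt_min hN0 (by positivity)
  have hσN : σ ≤ N := min_le_left _ _
  have hσB : B * σ ≤ c / 2 := by
    have : σ ≤ c / (2 * B) := min_le_right _ _
    rw [le_div_iff₀ (by positivity)] at this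
    linarith
  set γ := N - σ with hγ
  have hγ0 : 0 ≤ γ := by linarith
  have hγ1 : γ ≤ 1 := by linarith
  set f : Eucl n → ℝ := fun x => max (u x - ψ x - γ) 0 with hf
  have hfL : LipschitzOnWith (Ku + Kψ) f (closedBall 0 1) := by
    intro a ha b hb
    have h2 : LipschitzWith 1 fun t : ℝ => max (t - γ) 0 := by
      simpa using ((LipschitzWith.id (α := ℝ)).sub (LipschitzWith.const γ)).max_const 0
    simpa using (h2.comp_lipschitzOnWith (hKu.sub hKψ)) ha hb
  have hf0 : ∀ x ∈ closedBall (0 : Eucl n) 1, 3 / 4 ≤ ‖x‖ → f x = 0 := fun x hx hx' =>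
    max_eq_right (by have := hbd x hx hx'; linarith)
  obtain ⟨D, hD⟩ := exists_lipschitzWith_extend_zero hfL hf0
  set φ := (closedBall (0 : Eucl n) 1).indicator f with hφ
  have hφf : ∀ x ∈ closedBall (0 : Eucl n) 1, φ x = f x := fun x hx =>
    Set.indicator_of_mem hx f
  have hφ0 : ∀ x, 0 ≤ φ x := fun x =>
    Set.indicator_nonneg (fun x _ => le_max_right _ _) x
  have hφs : ∀ x, 3 / 4 ≤ ‖x‖ → φ x = 0 := fun x hx => by
    by_cases h : x ∈ closedBall (0 : Eucl n) 1
    · rw [hφf x h, hf0 x h hx]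
    · exact Set.indicator_of_notMem h f
  have hφσ : ∀ x, φ x ≤ σ := fun x => by
    by_cases h : x ∈ closedBall (0 : Eucl n) 1
    · rw [hφf x h]
      exact max_le (by have := hmaxN x h; linarith) hσ0.le
    · rw [hφ, Set.indicator_of_notMem h f]
      exact hσ0.le
  have hφy : φ y = σ := by
    rw [hφf y hy]
    have : u y - ψ y - γ = σ := by rw [← hN]; linarith
    simp only [hf, this]
    exact max_eq_left hσ0.le
  set Ψ : Eucl n → ℝ := fun x => ψ x + γ with hΨ
  have hΨ2 : ContDiff ℝ 2 Ψ := hψ.add contDiff_const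
  have hΨg : gradient Ψ = gradient ψ := by
    funext x
    simp [gradient, hΨ]
  have hball : ∀ x : Eucl n, ‖x‖ < 3 / 4 → x ∈ closedBall (0 : Eucl n) 1 := fun x hx => by
    simp; linarith
  have hΨM : ∀ x ∈ closedBall (0 : Eucl n) 1, |Ψ x| ≤ M := fun x hx => by
    have h2 : |ψ x| ≤ M₂ := hM₂ x hx
    have := abs_add_le (ψ x) γ
    rw [abs_of_nonneg hγ0] at this
    simp only [hΨ]
    linarith
  have hΨgM : ∀ x ∈ closedBall (0 : Eucl n) 1, ‖gradient Ψ x‖ ≤ M := fun x hx => by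
    rw [hΨg]
    have := hM₃ x hx
    linarith
  have huM : ∀ x ∈ closedBall (0 : Eucl n) 1, |u x| ≤ M := fun x hx => by
    have : |u x| ≤ M₁ := hM₁ x hx
    linarith
  have hugM : ∀ x, ‖x‖ < 1 → ‖gradient u x‖ ≤ M := fun x hx => by
    rw [norm_gradient]
    have := norm_fderiv_le_of_lipschitzOn ℝ
      (Filter.mem_of_superset (isOpen_ball.mem_nhds (by simpa using hx)) ball_subset_closedBall) hKu
    linarith
  have hsuper := supersolution_weak h0 hΨ2 (hsup γ hγ0 hγ1) hD hφ0 hφs hφσ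
    (fun x hx => hΨM x (hball x hx)) (fun x hx => hΨgM x (hball x hx))
  obtain ⟨hJ1, hJ2⟩ := integrableOn_pairing h0 hD hφ0 hφs hφσ
    hΨ2.continuous.measurable.aemeasurable (measurable_gradient Ψ).aemeasurable
    (fun x hx => hΨM x (hball x hx)) (fun x hx => hΨgM x (hball x hx))
  have hJ : IntegrableOn (fun x => ⟪F x (Ψ x) (gradient Ψ x), gradient φ x⟫_ℝ +
    F₀ x (Ψ x) (gradient Ψ x) * φ x) (ball 0 1) := hJ1.add hJ2
  obtain ⟨hG1, hG2⟩ := integrableOn_pairing h0 hD hφ0 hφs hφσ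
    ((hKu.continuousOn.mono ball_subset_closedBall).aemeasurable measurableSet_ball)
    (measurable_gradient u).aemeasurable
    (fun x hx => huM x (hball x hx)) (fun x hx => hugM x (by linarith))
  have hadm : AdmissibleThin g (fun x => u x - φ x) := by
    refine ⟨⟨Ku + D, hKu.sub hD.lipschitzOnWith⟩, fun x hx => ?_, fun x hx => ?_⟩
    · have : ‖x‖ = 1 := by simpa using hx
      simp only
      rw [hφs x (by rw [this]; norm_num), sub_zero, hug x hx]
    · have hx' : x ∈ closedBall (0 : Eucl n) 1 := ball_subset_closedBall hx.1
      have h2 := hu0 x hx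
      have h3 := hψ0 x hx
      have : φ x ≤ u x := by
        rw [hφf x hx']
        exact max_le (by linarith) h2
      linarith
  have hdu : ∀ᵐ x ∂(volume.restrict (ball (0 : Eucl n) 1)), DifferentiableAt ℝ u x := by
    filter_upwards [(hKu.mono ball_subset_closedBall).ae_differentiableWithinAt (μ := volume)
      measurableSet_ball, ae_restrict_mem measurableSet_ball] with x hx hxb
    exact hx.differentiableAt (isOpen_ball.mem_nhds hxb)
  have hdφ : ∀ᵐ x ∂(volume.restrict (ball (0 : Eucl n) 1)), DifferentiableAt ℝ φ x :=
    ae_restrict_of_ae hD.ae_differentiableAt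
  have hle : ∫ x in ball (0 : Eucl n) 1,
        (⟪F x (u x) (gradient u x), gradient (fun x => u x - φ x) x - gradient u x⟫_ℝ +
          F₀ x (u x) (gradient u x) * ((u x - φ x) - u x)) =
      ∫ x in ball (0 : Eucl n) 1, - (⟪F x (u x) (gradient u x), gradient φ x⟫_ℝ +
          F₀ x (u x) (gradient u x) * φ x) := by
    refine integral_congr_ae ?_
    filter_upwards [hdu, hdφ] with x hx1 hx2
    have : gradient (fun x => u x - φ x) x = gradient u x - gradient φ x := by
      simp [gradient, fderiv_fun_sub hx1 hx2]
    rw [this, sub_sub_cancel_left, inner_neg_right]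
    ring
  have hge := hvar _ hadm
  rw [hle] at hge
  have hiφ : IntegrableOn φ (ball (0 : Eucl n) 1) :=
    integrableOn_ball_of_bound hD.continuous.measurable.aemeasurable hσ0.le
      (fun x _ => by rw [abs_of_nonneg (hφ0 x)]; exact hφσ x) hφs
  have hcmp : ∫ x in ball (0 : Eucl n) 1, - (⟪F x (u x) (gradient u x), gradient φ x⟫_ℝ +
          F₀ x (u x) (gradient u x) * φ x) ≤
      ∫ x in ball (0 : Eucl n) 1, (c / 2 * φ x - (⟪F x (Ψ x) (gradient Ψ x), gradient φ x⟫_ℝ +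
        F₀ x (Ψ x) (gradient Ψ x) * φ x)) := by
    refine integral_mono_ae (Integrable.fun_neg (hG1.add hG2))
      ((hiφ.const_mul _).sub hJ) ?_
    filter_upwards [hdu, ae_restrict_mem measurableSet_ball] with x hx1 hxb
    by_cases hx0 : φ x = 0
    · simp [hx0, gradient_eq_zero_of_nonneg hφ0 hx0]
    have hpos : 0 < φ x := lt_of_le_of_ne (hφ0 x) (Ne.symm hx0)
    have hx34 : ‖x‖ < 3 / 4 := by
      by_contra! h
      exact hx0 (hφs x h)
    have hev : φ =ᶠ[𝓝 x] fun w => u w - Ψ w := by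
      filter_upwards [hD.continuous.continuousAt.eventually (lt_mem_nhds hpos),
        isOpen_ball.mem_nhds hxb] with w hw hwb
      have hw' := hφf w (ball_subset_closedBall hwb)
      rw [hw'] at hw ⊢
      simp only [hf, lt_max_iff, lt_self_iff_false, or_false] at hw
      simp only [hf, hΨ]
      rw [max_eq_left hw.le]
      ring
    have hgr : gradient φ x = gradient u x - gradient Ψ x := by
      rw [hev.gradient_eq]
      simp [gradient, fderiv_fun_sub hx1 (hΨ2.differentiable two_ne_zero x)]
    have hval : φ x = u x - Ψ x := hev.eq_of_nhds
    have := hpt x (u x) (Ψ x) (gradient u x) (gradient Ψ x) hx34.le (huM x (hball x hx34))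
      (hΨM x (hball x hx34)) (hugM x (by linarith)) (hΨgM x (hball x hx34)) (by linarith)
    rw [← hgr, ← hval] at this
    have h3 : B * φ x ^ 2 ≤ c / 2 * φ x := by
      have h4 := mul_le_mul_of_nonneg_left (hφσ x) hB.le
      have h5 := mul_le_mul_of_nonneg_right (h4.trans hσB) (hφ0 x)
      linarith
    linarith
  rw [integral_sub (hiφ.const_mul _) hJ, integral_const_mul] at hcmp
  have hint : 0 < ∫ x in ball (0 : Eucl n) 1, φ x := by
    rw [setIntegral_eq_integral_of_forall_compl_eq_zero fun x hx =>
      hφs x (by simp at hx; linarith)]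
    refine hD.continuous.integral_pos_of_hasCompactSupport_nonneg_nonzero (x := y) ?_ hφ0
      (by rw [hφy]; exact hσ0.ne')
    exact HasCompactSupport.intro (isCompact_closedBall (0 : Eucl n) (3 / 4)) fun x hx =>
      hφs x (by simp at hx; exact hx.le)
  nlinarith [mul_pos hc hint]

/-- The diagonal quadratic `∑ᵢ aᵢ (xᵢ - yᵢ)² + m x_{n+1} + γ`. -/
def diagQuad (a : Fin (n + 1) → ℝ) (y : Eucl n) (m γ : ℝ) (x : Eucl n) : ℝ :=
  ∑ i, a i * (x i - y i) ^ 2 + m * x (Fin.last n) + γ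

/-- The gradient of `diagQuad`. -/
def diagQuadGrad (a : Fin (n + 1) → ℝ) (y : Eucl n) (m : ℝ) (x : Eucl n) : Eucl n :=
  ∑ i, (2 * a i * (x i - y i)) • EuclideanSpace.single i (1 : ℝ) + m • eLast n

lemma contDiff_diagQuad (a : Fin (n + 1) → ℝ) (y : Eucl n) (m γ : ℝ) :
    ContDiff ℝ 2 (diagQuad a y m γ) := by
  have hp : ∀ i, ContDiff ℝ 2 fun x : Eucl n => x i := fun i =>
    (EuclideanSpace.proj (𝕜 := ℝ) i).contDiff
  exact ((ContDiff.sum fun i _ => contDiff_const.mul (((hp i).sub contDiff_const).pow 2)).add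
    (contDiff_const.mul (hp _))).add contDiff_const

lemma gradient_diagQuad (a : Fin (n + 1) → ℝ) (y : Eucl n) (m γ : ℝ) :
    gradient (diagQuad a y m γ) = diagQuadGrad a y m := by
  refine gradient_eq fun x => ?_
  have hp : ∀ i, HasFDerivAt (fun x : Eucl n => x i) (EuclideanSpace.proj (𝕜 := ℝ) i) x := fun i =>
    (EuclideanSpace.proj (𝕜 := ℝ) i).hasFDerivAt
  rw [hasGradientAt_iff_hasFDerivAt]
  have h := ((HasFDerivAt.fun_sum (u := Finset.univ) fun i _ =>
    (((hp i).sub_const (y i)).pow 2).const_mul (a i)).add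
      ((hp (Fin.last n)).const_mul m)).add_const γ
  convert! h using 1
  ext v
  simp [diagQuadGrad, eLast, EuclideanSpace.inner_single_left]
  exact Finset.sum_congr rfl fun i _ => by ring

lemma fderiv_diagQuadGrad (a : Fin (n + 1) → ℝ) (y : Eucl n) (m : ℝ) (x : Eucl n)
    (j : Fin (n + 1)) :
    fderiv ℝ (diagQuadGrad a y m) x (EuclideanSpace.single j 1) =
      (2 * a j) • EuclideanSpace.single j (1 : ℝ) := by
  have hp : ∀ i, HasFDerivAt (fun x : Eucl n => x i) (EuclideanSpace.proj (𝕜 := ℝ) i) x := fun i =>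
    (EuclideanSpace.proj (𝕜 := ℝ) i).hasFDerivAt
  have h : HasFDerivAt (diagQuadGrad a y m) _ x := (HasFDerivAt.fun_sum (u := Finset.univ)
    fun i _ => (((hp i).sub_const (y i)).const_mul (2 * a i)).smul_const
      (EuclideanSpace.single i (1 : ℝ))).add_const (m • eLast n)
  rw [h.fderiv]
  simp [ite_smul]

lemma abs_diagQuad_le {a : Fin (n + 1) → ℝ} {b : ℝ} (ha : ∀ i, |a i| ≤ b) (y : Eucl n) (m : ℝ)
    {γ : ℝ} (x : Eucl n) :
    |diagQuad a y m γ x| ≤ b * ‖x - y‖ ^ 2 + |m| * ‖x‖ + |γ| := by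
  have h1 : |∑ i, a i * (x i - y i) ^ 2| ≤ b * ‖x - y‖ ^ 2 := by
    rw [EuclideanSpace.real_norm_sq_eq, Finset.mul_sum]
    refine (Finset.abs_sum_le_sum_abs _ _).trans (Finset.sum_le_sum fun i _ => ?_)
    rw [abs_mul, abs_of_nonneg (sq_nonneg (x i - y i))]
    exact mul_le_mul_of_nonneg_right (ha i) (sq_nonneg _)
  have h2 : |m * x (Fin.last n)| ≤ |m| * ‖x‖ := by
    rw [abs_mul]
    exact mul_le_mul_of_nonneg_left (PiLp.norm_apply_le x (Fin.last n)) (abs_nonneg _)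
  exact (abs_add_le _ _).trans (add_le_add ((abs_add_le _ _).trans (add_le_add h1 h2)) le_rfl)

lemma norm_diagQuadGrad_le {a : Fin (n + 1) → ℝ} {b : ℝ} (ha : ∀ i, |a i| ≤ b) (y : Eucl n)
    (m : ℝ) (x : Eucl n) :
    ‖diagQuadGrad a y m x‖ ≤ 2 * b * ‖x - y‖ + |m| := by
  have hb : 0 ≤ b := (abs_nonneg _).trans (ha 0)
  refine (norm_add_le _ _).trans (add_le_add ?_ (by simp [eLast, norm_smul]))
  refine abs_le_of_sq_le_sq' ?_ (by positivity) |>.2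
  rw [mul_pow, EuclideanSpace.real_norm_sq_eq, EuclideanSpace.real_norm_sq_eq, Finset.mul_sum]
  refine Finset.sum_le_sum fun i _ => ?_
  have : (∑ j, (2 * a j * (x j - y j)) • EuclideanSpace.single j (1 : ℝ) : Eucl n) i =
      2 * a i * (x i - y i) := by
    simp [Pi.single_apply]
  rw [this, mul_pow]
  refine mul_le_mul_of_nonneg_right ?_ (sq_nonneg _)
  rw [mul_pow, mul_pow]
  have := sq_le_sq' (abs_le.1 (ha i)).1 (abs_le.1 (ha i)).2
  linarith

/-- The barrier weights: `t` in the tangential directions, `-t K` in the normal direction. -/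
def barrierWeight (n : ℕ) (t K : ℝ) (i : Fin (n + 1)) : ℝ :=
  if i = Fin.last n then -(t * K) else t

lemma barrier_hop_ge {F : Eucl n → ℝ → Eucl n → Eucl n} {F₀ : Eucl n → ℝ → Eucl n → ℝ}
    {lam L : ℝ → ℝ} {ε M t K : ℝ} (h1 : H1With lam F) (hR : Rescaled ε L F F₀) (hM : 0 < M)
    (ht : 0 < t) (hK : 0 < K) (hKM : n * |L M| + 1 ≤ K * lam M) (hε : ε * |L M| ≤ t)
    (hε0 : 0 ≤ ε) {y x : Eucl n} {m γ : ℝ} (hx : x ∈ ball (0 : Eucl n) 1)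
    (hz : |diagQuad (barrierWeight n t K) y m γ x| ≤ M)
    (hp : ‖diagQuadGrad (barrierWeight n t K) y m x‖ ≤ M) :
    t ≤ Hop F F₀ (diagQuad (barrierWeight n t K) y m γ) x := by
  set a := barrierWeight n t K with ha
  set z := diagQuad a y m γ x with hzdef
  set p := diagQuadGrad a y m x with hpdef
  obtain ⟨hlow, hD⟩ := hR M hM x hx z hz p hp
  have hell := (h1 M hM).2 x hx z hz p hp
  set D := fderiv ℝ (F x z) p with hDdef
  have htr : ∑ i : Fin (n + 1),
      ⟪D (fderiv ℝ (diagQuadGrad a y m) x (EuclideanSpace.single i 1)),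
        EuclideanSpace.single i 1⟫_ℝ ≤ -(2 * t) := by
    simp only [fderiv_diagQuadGrad, map_smul, inner_smul_left]
    rw [Fin.sum_univ_castSucc]
    have htan : ∀ i : Fin n, (starRingEnd ℝ) (2 * a i.castSucc) *
        ⟪D (EuclideanSpace.single i.castSucc 1), EuclideanSpace.single i.castSucc 1⟫_ℝ ≤
        2 * t * |L M| := fun i => by
      have e : a i.castSucc = t := if_neg (Fin.castSucc_lt_last i).ne
      have hin : ⟪D (EuclideanSpace.single i.castSucc 1),
          EuclideanSpace.single i.castSucc 1⟫_ℝ ≤ |L M| := by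
        refine (real_inner_le_norm _ _).trans ?_
        have := D.le_opNorm (EuclideanSpace.single i.castSucc 1)
        simp only [PiLp.norm_single, norm_one, mul_one] at this ⊢
        exact this.trans (hD.trans (le_abs_self _))
      simp only [e, conj_trivial]
      exact mul_le_mul_of_nonneg_left hin (by positivity)
    have hnor := hell (EuclideanSpace.single (Fin.last n) 1)
    simp only [PiLp.norm_single, norm_one, one_pow, mul_one] at hnor
    have el : a (Fin.last n) = -(t * K) := if_pos rfl
    have hsum := Finset.sum_le_sum fun i (_ : i ∈ Finset.univ) => htan i
    simp only [Finset.sum_const, Finset.card_univ, Fintype.card_fin, nsmul_eq_mul] at hsum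
    simp only [el, conj_trivial] at hsum ⊢
    have h3 := mul_le_mul_of_nonneg_left hnor (show 0 ≤ 2 * t * K by positivity)
    have h4 := mul_le_mul_of_nonneg_left hKM (show 0 ≤ 2 * t by positivity)
    linarith
  have h5 : ε * L M ≤ t := (mul_le_mul_of_nonneg_left (le_abs_self _) hε0).trans hε
  have h6 := (abs_le.1 hlow).1
  simp only [Hop, gradient_diagQuad]
  linarith

/-- The barrier lies above the wedge, with a quadratic gap away from the contact point. -/
lemma wedge_le_barrier {ap am t K : ℝ} (hlt : ap < am) (ht : t ≤ (am - ap) / 4)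
    (htK : t * K ≤ (am - ap) / 4) {x y : Eucl n} (hx : ‖x‖ ≤ 1)
    (hy : y (Fin.last n) = 0) :
    (if 0 ≤ x (Fin.last n) then ap * x (Fin.last n) else am * x (Fin.last n)) +
      t * ‖x - y‖ ^ 2 ≤ diagQuad (barrierWeight n t K) y ((ap + am) / 2) 0 x := by
  rw [EuclideanSpace.real_norm_sq_eq, diagQuad, Fin.sum_univ_castSucc, Fin.sum_univ_castSucc]
  have e : ∀ i : Fin n, barrierWeight n t K i.castSucc = t := fun i =>
    if_neg (Fin.castSucc_lt_last i).ne
  have el : barrierWeight n t K (Fin.last n) = -(t * K) := if_pos rfl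
  simp only [e, el, hy, PiLp.sub_apply, sub_zero, mul_add, Finset.mul_sum, add_zero]
  set s := x (Fin.last n) with hs
  have hs1 : |s| ≤ 1 := (PiLp.norm_apply_le x (Fin.last n)).trans hx
  obtain ⟨hl, hr⟩ := abs_le.1 hs1
  have h1 : (t + t * K) * s ^ 2 ≤ (am - ap) / 2 * s ^ 2 :=
    mul_le_mul_of_nonneg_right (by linarith) (sq_nonneg _)
  split_ifs with h
  · nlinarith [mul_nonneg (mul_nonneg h (sub_nonneg.2 hr)) (sub_pos.2 hlt).le]
  · push Not at h
    nlinarith [mul_nonneg (mul_nonneg (neg_pos.2 h).le (neg_le_iff_add_nonneg.1 hl))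
      (sub_pos.2 hlt).le]


lemma abs_barrierWeight_le {t K b : ℝ} (ht : |t| ≤ b) (htK : |t * K| ≤ b) (i : Fin (n + 1)) :
    |barrierWeight n t K i| ≤ b := by
  rw [barrierWeight]
  split_ifs
  · rwa [abs_neg]
  · exact ht

end TOP

open TOP in
/-- Proposition: wedge profiles force coincidence. If `a⁺ < a⁻`,
there is `ε > 0`, depending only on `n`, `a⁺`, `a⁻` and the functions `λ(·)`, `L(·)`,
such that any Lipschitz solution of the thin obstacle problem with an `ε`-rescaled
operator lying below the wedge `w(x_{n+1}) + ε` on `B₁` vanishes on `B'_{1/2}`. -/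
theorem wedge_implies_coincidence (n : ℕ) (ap am : ℝ) (hlt : ap < am) (lam L : ℝ → ℝ) :
    ∃ ε : ℝ, 0 < ε ∧
      ∀ (F : Eucl n → ℝ → Eucl n → Eucl n) (F₀ : Eucl n → ℝ → Eucl n → ℝ)
        (g u : Eucl n → ℝ),
        H0 F F₀ → H1With lam F → Rescaled ε L F F₀ →
        ThinSolution F F₀ g u →
        (∀ x ∈ Metric.ball (0 : Eucl n) 1,
          u x ≤ (if 0 ≤ x (Fin.last n) then ap * x (Fin.last n)
                 else am * x (Fin.last n)) + ε) →
        ∀ x ∈ tBall (0 : Eucl n) (1 / 2), u x = 0 := by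
  set δ := am - ap with hδ
  set m := (ap + am) / 2 with hm
  have hδ0 : 0 < δ := sub_pos.2 hlt
  set M := δ + |m| + 1 with hM
  have hM0 : 0 < M := by positivity
  by_cases hl : 0 < lam M
  swap
  · exact ⟨1, one_pos, fun F F₀ g u _ h1 => (hl (h1 M hM0).1).elim⟩
  set K := (n * |L M| + 1) / lam M + 1 with hK
  have hK1 : 1 ≤ K := le_add_of_nonneg_left (by positivity)
  have hK0 : 0 < K := one_pos.trans_le hK1
  have hKM : n * |L M| + 1 ≤ K * lam M := by
    rw [hK, add_mul, div_mul_cancel₀ _ hl.ne']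
    linarith
  set t := δ / 4 / K with ht
  have ht0 : 0 < t := by positivity
  have htK : t * K = δ / 4 := div_mul_cancel₀ _ hK0.ne'
  have htδ : t ≤ δ / 4 := div_le_self (by positivity) hK1
  set ε := min 1 (min (t / 16) (t / (|L M| + 1))) with hε
  have hε0 : 0 < ε := by positivity
  have hε1 : ε ≤ 1 := min_le_left _ _
  have hε2 : ε ≤ t / 16 := (min_le_right _ _).trans (min_le_left _ _)
  have hε3 : ε * |L M| ≤ t := by
    have h : ε ≤ t / (|L M| + 1) := (min_le_right _ _).trans (min_le_right _ _)
    rw [le_div_iff₀ (by positivity)] at h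
    linarith
  refine ⟨ε, hε0, fun F F₀ g u h0 h1 hR hu hw y hy => ?_⟩
  have hyn : ‖y‖ < 1 / 2 := mem_ball_zero_iff.1 hy.1
  have hyl : y (Fin.last n) = 0 := hy.2
  have hyB : y ∈ tBall (0 : Eucl n) 1 := ⟨ball_subset_ball (by norm_num) hy.1, hyl⟩
  set ψ := diagQuad (barrierWeight n t K) y m 0 with hψ
  have hψ2 : ContDiff ℝ 2 ψ := contDiff_diagQuad _ _ _ _
  have ha : ∀ i, |barrierWeight n t K i| ≤ δ / 4 :=
    abs_barrierWeight_le (by rwa [abs_of_pos ht0]) (by rw [htK, abs_of_pos (by positivity)])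
  have hub : ∀ x ∈ closedBall (0 : Eucl n) 1, u x + t * ‖x - y‖ ^ 2 ≤ ψ x + ε := by
    obtain ⟨C, hC⟩ := hu.1.1
    rw [← closure_ball (0 : Eucl n) one_ne_zero] at hC ⊢
    have hcont : Continuous fun x : Eucl n => t * ‖x - y‖ ^ 2 := by fun_prop
    refine fun x hx => le_on_closure (fun x hx => ?_) (hC.continuousOn.add hcont.continuousOn)
      (hψ2.continuous.continuousOn.add continuousOn_const) hx
    have hbar := wedge_le_barrier hlt htδ htK.le (mem_ball_zero_iff.1 hx).le hyl
    change u x + t * ‖x - y‖ ^ 2 ≤ ψ x + ε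
    linarith [hw x hx]
  have hle : u y ≤ ψ y := by
    refine hu.le_of_supersolution h0 h1 hψ2 (fun x hx => ?_) ht0
      (fun γ hγ0 hγ1 x hx => ?_) (fun x hx hx' => ?_) (fun x hx => ?_) y
      (ball_subset_closedBall hyB.1)
    · have hbar := wedge_le_barrier hlt htδ htK.le (mem_ball_zero_iff.1 hx.1).le hyl
      have hxl : x (Fin.last n) = 0 := hx.2
      simp only [hxl, mul_zero, ite_self, zero_add] at hbar
      exact (by positivity : (0 : ℝ) ≤ t * ‖x - y‖ ^ 2).trans hbar
    · have hfun : (fun x => ψ x + γ) = diagQuad (barrierWeight n t K) y m γ := by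
        funext x
        simp [hψ, diagQuad]
      rw [hfun]
      have hxn : ‖x‖ ≤ 1 := (mem_ball_zero_iff.1 hx).le
      have hxy : ‖x - y‖ ≤ 3 / 2 := (norm_sub_le _ _).trans (by linarith)
      have hxy2 : ‖x - y‖ ^ 2 ≤ (3 / 2) ^ 2 := pow_le_pow_left₀ (norm_nonneg _) hxy 2
      have hmx : |m| * ‖x‖ ≤ |m| := mul_le_of_le_one_right (abs_nonneg _) hxn
      refine barrier_hop_ge h1 hR hM0 ht0 hK0 hKM hε3 hε0.le hx
        ((abs_diagQuad_le ha y m x).trans ?_) ((norm_diagQuadGrad_le ha y m x).trans ?_)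
      · rw [abs_of_nonneg hγ0]
        nlinarith
      · nlinarith
    · have hxy : 1 / 4 ≤ ‖x - y‖ := by linarith [norm_sub_norm_le x y]
      have hxy2 : (1 / 4) ^ 2 ≤ ‖x - y‖ ^ 2 := pow_le_pow_left₀ (by norm_num) hxy 2
      nlinarith [hub x hx]
    · have : 0 ≤ t * ‖x - y‖ ^ 2 := by positivity
      linarith [hub x hx]
  have hψy : ψ y = 0 := by simp [hψ, diagQuad, hyl]
  exact le_antisymm (hle.trans_eq hψy) (hu.1.2.2 y hyB)
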